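/- There exists a 5 × 2 matrix M of homogeneous polynomials in ℂ[x₀,x₁,x₂,x₃], whose first column consists of quadratic forms (degree 2) and whose second column consists of linear forms (degree 1), such that for every point p ∈ ℂ⁴ ∖ {0} the complex 5 × 2 matrix M(p) obtained by evaluating the entries at p has rank 2. (Such a matrix defines an injection of vector bundles 𝒪(−2) ⊕ 𝒪(−1) → 5𝒪 on P³ whose cokernel is a rank-3 vector bundle E with c₁ = 3, c₂ = 7, c₃ = 15, arising from an arithmetically Cohen–Macaulay curve of degree 7 and genus 5 linked to a conic in a complete intersection of type (3,3).) -/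

import Mathlib

open MvPolynomial

/-- If `x i ^ 2 = c * x i` for all `i` and `∑ i, x i ^ 2 = 0`, then `x = 0`: the nonzero solutions
of the first system are, up to scaling, the vectors with entries `0` and `1`. -/
lemma eq_zero_of_sq_eq_mul_of_sum_sq_eq_zero {K ι : Type*} [Field K] [CharZero K] [Fintype ι]
    {x : ι → K} {c : K} (hx : ∀ i, x i ^ 2 = c * x i) (hsum : ∑ i, x i ^ 2 = 0) : x = 0 := by
  classical
  have hc : ∀ i, x i ≠ 0 → x i = c := fun i hi =>
    mul_right_cancel₀ hi (by rw [← hx i, sq])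
  have hcount : ∑ i, x i ^ 2 = ((Finset.univ.filter fun i => x i ≠ 0).card : K) * c ^ 2 := by
    rw [← nsmul_eq_mul, ← Finset.sum_const, Finset.sum_filter]
    refine Finset.sum_congr rfl fun i _ => ?_
    split_ifs with hi
    · rw [hc i hi]
    · simp [not_not.mp hi]
  funext i
  by_contra hi
  rw [hcount, mul_eq_zero, Nat.cast_eq_zero, Finset.card_eq_zero] at hsum
  rcases hsum with h | h
  · exact Finset.notMem_empty i (h ▸ Finset.mem_filter.mpr ⟨Finset.mem_univ i, hi⟩)
  · exact hi ((hc i hi).trans (pow_eq_zero_iff two_ne_zero |>.mp h))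

/-- There is a `5 × 2` matrix of homogeneous polynomials on `ℂ⁴`, with quadratic
forms in the first column and linear forms in the second column, whose evaluation at
every nonzero point of `ℂ⁴` has rank `2` (defining an injection of vector bundles
`𝒪(−2) ⊕ 𝒪(−1) → 5𝒪` on `P³` with rank-3 globally generated cokernel `E`,
`c₁ = 3`, `c₂ = 7`, `c₃ = 15`). -/
theorem exists_five_by_two_quadratic_linear_matrix_of_full_rank :
    ∃ M : Matrix (Fin 5) (Fin 2) (MvPolynomial (Fin 4) ℂ),
      (∀ i, (M i 0).IsHomogeneous 2) ∧
      (∀ i, (M i 1).IsHomogeneous 1) ∧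
      (∀ p : Fin 4 → ℂ, p ≠ 0 → (M.map (eval p)).rank = 2) := by
  refine ⟨Matrix.of (Fin.cons ![∑ i, X i ^ 2, 0] fun i => ![X i ^ 2, X i]), ?_, ?_, ?_⟩
  · refine Fin.cases ?_ fun i => ?_
    · exact IsHomogeneous.sum Finset.univ _ 2 fun i _ => isHomogeneous_X_pow (R := ℂ) i 2
    · exact isHomogeneous_X_pow (R := ℂ) i 2
  · refine Fin.cases ?_ fun i => ?_
    · exact isHomogeneous_zero (Fin 4) ℂ 1
    · exact isHomogeneous_X ℂ i
  · intro p hp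
    rw [← Matrix.rank_transpose]
    refine (LinearIndependent.rank_matrix ?_).trans (Fintype.card_fin 2)
    rw [Fintype.linearIndependent_iff]
    intro g hg
    have hzero : g 0 * ∑ i, p i ^ 2 = 0 := by
      simpa [Fin.sum_univ_two, Matrix.row] using congrFun hg 0
    have hsucc : ∀ i, g 0 * p i ^ 2 + g 1 * p i = 0 := fun i => by
      simpa [Fin.sum_univ_two, Matrix.row] using congrFun hg i.succ
    have hg0 : g 0 = 0 := by
      by_contra hg0
      refine hp (eq_zero_of_sq_eq_mul_of_sum_sq_eq_zero (c := -g 1 / g 0) (fun i => ?_)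
        ((mul_eq_zero.mp hzero).resolve_left hg0))
      field_simp
      linear_combination hsucc i
    obtain ⟨i, hi⟩ := Function.ne_iff.mp hp
    have hg1 : g 1 = 0 :=
      (mul_eq_zero.mp (by simpa only [hg0, zero_mul, zero_add] using hsucc i)).resolve_right hi
    exact Fin.forall_fin_two.mpr ⟨hg0, hg1⟩
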